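/- Let 0 < ρ ≤ 1, let n = k·m for natural numbers k, m ≥ 1, and let W = {((2i−1)/(2k), (2j−1)·ρ/(2m)) : 1 ≤ i ≤ k, 1 ≤ j ≤ m} ⊆ Q be a regular grid placement of n points. Then there exists a finite set B ⊆ Q with |B| = n and μ({q ∈ Q : infDist(q, B) < infDist(q, W)}) > ρ/2 if and only if there exists a single point p ∈ Q with μ({q ∈ Q : dist(q, p) < infDist(q, W)}) > ρ/(2n). (Barney wins if and only if one point can steal an area strictly larger than μ(Q)/(2n).) -/

import Mathlib

open MeasureTheory Metric Set
open scoped ENNReal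

/-- The point `(x, y)` in the Euclidean plane. -/
noncomputable def pt (x y : ℝ) : EuclideanSpace ℝ (Fin 2) :=
  (WithLp.equiv 2 (Fin 2 → ℝ)).symm ![x, y]

/-- The rectangular board `[0,1] × [0,ρ]`. -/
def board (ρ : ℝ) : Set (EuclideanSpace ℝ (Fin 2)) :=
  {q | q 0 ∈ Set.Icc (0:ℝ) 1 ∧ q 1 ∈ Set.Icc (0:ℝ) ρ}

/-- open cell around `w` -/
def cell (w : EuclideanSpace ℝ (Fin 2)) (a b : ℝ) : Set (EuclideanSpace ℝ (Fin 2)) :=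
  {q | |q 0 - w 0| < a ∧ |q 1 - w 1| < b}

lemma cell_open (w : EuclideanSpace ℝ (Fin 2)) (a b : ℝ) : IsOpen (cell w a b) := by
  have h1 : IsOpen {q : EuclideanSpace ℝ (Fin 2) | |q 0 - w 0| < a} :=
    isOpen_lt (by fun_prop) (by fun_prop)
  have h2 : IsOpen {q : EuclideanSpace ℝ (Fin 2) | |q 1 - w 1| < b} :=
    isOpen_lt (by fun_prop) (by fun_prop)
  exact h1.inter h2

lemma half_open (w v : EuclideanSpace ℝ (Fin 2)) (a b t : ℝ) :
    IsOpen {q | q ∈ cell w a b ∧ inner ℝ (q - w) v < t} := by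
  have h1 : IsOpen {q : EuclideanSpace ℝ (Fin 2) | inner ℝ (q - w) v < t} :=
    isOpen_lt (by fun_prop) (by fun_prop)
  exact (cell_open w a b).inter h1

lemma vol_cell (w : EuclideanSpace ℝ (Fin 2)) (a b : ℝ) (ha : 0 < a) (hb : 0 < b) :
    volume (cell w a b) = ENNReal.ofReal (4 * a * b) := by
  have h : cell w a b = (@WithLp.ofLp 2 (Fin 2 → ℝ)) ⁻¹'
      (Set.pi univ fun i => Ioo (![w 0 - a, w 1 - b] i) (![w 0 + a, w 1 + b] i)) := by
    ext q
    simp only [cell, mem_ofPred_eq, mem_preimage, Set.mem_pi, mem_univ, true_imp_iff,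
      Fin.forall_fin_two, mem_Ioo, abs_lt]
    simp
    constructor
    · rintro ⟨⟨_, _⟩, _, _⟩
      refine ⟨⟨?_, ?_⟩, ?_, ?_⟩ <;> linarith
    · rintro ⟨⟨_, _⟩, _, _⟩
      refine ⟨⟨?_, ?_⟩, ?_, ?_⟩ <;> linarith
  rw [h, (PiLp.volume_preserving_ofLp (Fin 2)).measure_preimage
    (MeasurableSet.univ_pi fun i => measurableSet_Ioo).nullMeasurableSet, Real.volume_pi_Ioo]
  simp only [Fin.prod_univ_two]
  rw [← ENNReal.ofReal_mul]
  · congr 1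
    simp
    ring
  · simp
    linarith

lemma vol_line (w v : EuclideanSpace ℝ (Fin 2)) (hv : v ≠ 0) :
    volume {q | inner ℝ (q - w) v = 0} = 0 := by
  have h0 : volume ((LinearMap.ker (innerSL ℝ v).toLinearMap : Submodule ℝ _) :
      Set (EuclideanSpace ℝ (Fin 2))) = 0 := by
    apply Measure.addHaar_submodule
    intro h
    have : v ∈ LinearMap.ker (innerSL ℝ v).toLinearMap := h ▸ Submodule.mem_top
    simp at this
    exact hv this
  have h1 : {q | inner ℝ (q - w) v = 0} = (fun q => q + (-w)) ⁻¹'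
    ((LinearMap.ker (innerSL ℝ v).toLinearMap : Submodule ℝ _) :
      Set (EuclideanSpace ℝ (Fin 2))) := by
    ext q
    simp [real_inner_comm, sub_eq_add_neg]
  rw [h1, measure_preimage_add_right, h0]

lemma vol_half (w v : EuclideanSpace ℝ (Fin 2)) (hv : v ≠ 0) (a b : ℝ) (ha : 0 < a) (hb : 0 < b) :
    volume {q | q ∈ cell w a b ∧ inner ℝ (q - w) v < 0} = ENNReal.ofReal (2 * a * b) := by
  set S := {q | q ∈ cell w a b ∧ inner ℝ (q - w) v < 0} with hS
  set T := {q | q ∈ cell w a b ∧ 0 < inner ℝ (q - w) v} with hT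
  have hTS : volume T = volume S := by
    have : T = (fun q => (w + w) - q) ⁻¹' S := by
      ext q
      have e : w + w - q - w = -(q - w) := by abel
      have e0 : w 0 + w 0 - q 0 - w 0 = -(q 0 - w 0) := by ring
      have e1 : w 1 + w 1 - q 1 - w 1 = -(q 1 - w 1) := by ring
      simp only [hT, hS, cell, mem_preimage, mem_ofPred_eq, e, inner_neg_left, PiLp.sub_apply,
        PiLp.add_apply, e0, e1, abs_neg, neg_lt_zero]
    rw [this]
    exact (Measure.measurePreserving_sub_left volume (w + w)).measure_preimage
      (half_open w v a b 0).measurableSet.nullMeasurableSet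
  have hle : volume (cell w a b) ≤ volume S + volume T := by
    calc volume (cell w a b) ≤ volume ((S ∪ T) ∪ {q | inner ℝ (q - w) v = 0}) := by
          apply measure_mono
          intro q hq
          rcases lt_trichotomy (inner ℝ (q - w) v) 0 with h | h | h
          · exact Or.inl (Or.inl ⟨hq, h⟩)
          · exact Or.inr h
          · exact Or.inl (Or.inr ⟨hq, h⟩)
      _ ≤ volume (S ∪ T) + 0 := by
          rw [← vol_line w v hv]; exact measure_union_le _ _
      _ ≤ _ := by rw [add_zero]; exact measure_union_le _ _
  have hge : volume S + volume T ≤ volume (cell w a b) := by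
    rw [add_comm, ← measure_union _ (half_open w v a b 0).measurableSet]
    · apply measure_mono
      rintro q (h | h) <;> exact h.1
    · rw [Set.disjoint_left]
      rintro q h h'
      exact lt_asymm h.2 h'.2
  have := le_antisymm hle hge
  rw [hTS, vol_cell w a b ha hb] at this
  have hab : 0 < a * b := mul_pos ha hb
  have h4 : ENNReal.ofReal (4 * a * b) = 2 * ENNReal.ofReal (2 * a * b) := by
    rw [show (2 : ℝ≥0∞) = ENNReal.ofReal 2 by simp, ← ENNReal.ofReal_mul (by norm_num)]
    congr 1; ring
  rw [h4, ← two_mul] at this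
  exact ((ENNReal.mul_right_inj (by norm_num) (by norm_num)).1 this).symm

lemma half_tendsto (w v : EuclideanSpace ℝ (Fin 2)) (hv : v ≠ 0) (a b : ℝ)
    (ha : 0 < a) (hb : 0 < b) :
    Filter.Tendsto (fun j : ℕ => volume
      {q | q ∈ cell w a b ∧ inner ℝ (q - w) v < -((1 / ((j : ℝ) + 1)) * ‖v‖ ^ 2 / 2)})
      Filter.atTop (nhds (ENNReal.ofReal (2 * a * b))) := by
  rw [← vol_half w v hv a b ha hb]
  have hu : {q | q ∈ cell w a b ∧ inner ℝ (q - w) v < 0} = ⋃ j : ℕ,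
      {q | q ∈ cell w a b ∧ inner ℝ (q - w) v < -((1 / ((j : ℝ) + 1)) * ‖v‖ ^ 2 / 2)} := by
    have hpos : 0 < ‖v‖ ^ 2 / 2 := by positivity
    ext q
    simp only [mem_ofPred_eq, mem_iUnion]
    constructor
    · rintro ⟨h, h'⟩
      obtain ⟨j, hj⟩ := exists_nat_one_div_lt (div_pos (neg_pos.2 h') hpos)
      refine ⟨j, h, ?_⟩
      rw [lt_div_iff₀ hpos] at hj
      linarith
    · rintro ⟨j, h, h'⟩
      refine ⟨h, h'.trans_le ?_⟩
      have : 0 ≤ (1 / ((j : ℝ) + 1)) * ‖v‖ ^ 2 / 2 := by positivity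
      linarith
  rw [hu]
  apply tendsto_measure_iUnion_atTop
  intro i j hij q hq
  refine ⟨hq.1, hq.2.trans_le ?_⟩
  have : 1 / ((j : ℝ) + 1) ≤ 1 / ((i : ℝ) + 1) := Nat.one_div_le_one_div hij
  have := mul_le_mul_of_nonneg_right this (sq_nonneg ‖v‖)
  linarith

/-- Separated grid coordinates. -/
lemma grid_sep (c x : ℝ) (hc : 0 < c) (i i' : ℕ) (hx : |x - (2 * i + 1) * c| < c) :
    |x - (2 * i + 1) * c| ≤ |x - (2 * i' + 1) * c| ∧
    (|x - (2 * i' + 1) * c| < c → i = i') := by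
  rcases lt_trichotomy i i' with h | h | h
  · have h1 : (i : ℝ) + 1 ≤ i' := by exact_mod_cast h
    have h2 := mul_le_mul_of_nonneg_right h1 hc.le
    rw [abs_lt] at hx
    have : c ≤ |x - (2 * i' + 1) * c| := by
      rw [le_abs]; right; nlinarith
    exact ⟨(abs_lt.2 hx).le.trans this, fun h => absurd h this.not_gt⟩
  · subst h; simp
  · have h1 : (i' : ℝ) + 1 ≤ i := by exact_mod_cast h
    have h2 := mul_le_mul_of_nonneg_right h1 hc.le
    rw [abs_lt] at hx
    have : c ≤ |x - (2 * i' + 1) * c| := by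
      rw [le_abs]; left; nlinarith
    exact ⟨(abs_lt.2 hx).le.trans this, fun h => absurd h this.not_gt⟩

lemma grid_bd (c : ℝ) (hc : 0 < c) (k i : ℕ) (hi : i < k) :
    c ≤ (2 * i + 1) * c ∧ (2 * i + 1) * c ≤ 2 * k * c - c := by
  have h1 : (i : ℝ) + 1 ≤ k := by exact_mod_cast hi
  have h2 := mul_le_mul_of_nonneg_right h1 hc.le
  have : 0 ≤ (i : ℝ) * c := by positivity
  constructor <;> nlinarith

lemma closer_iff (q w v : EuclideanSpace ℝ (Fin 2)) (e : ℝ) (he : 0 < e)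
    (h : inner ℝ (q - w) v < -(e * ‖v‖ ^ 2 / 2)) : dist q (w - e • v) < dist q w := by
  rw [dist_eq_norm, dist_eq_norm]
  apply lt_of_pow_lt_pow_left₀ 2 (norm_nonneg _)
  have e1 : q - (w - e • v) = (q - w) + e • v := by abel
  rw [e1, norm_add_sq_real, inner_smul_right, norm_smul, Real.norm_eq_abs, mul_pow, sq_abs]
  nlinarith

lemma steal_inner (q w p : EuclideanSpace ℝ (Fin 2)) (h : dist q p < dist q w) :
    0 < inner ℝ (q - w) (p - w) := by
  rw [dist_eq_norm, dist_eq_norm] at h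
  have h2 := pow_lt_pow_left₀ h (norm_nonneg _) (two_ne_zero)
  have e1 : q - p = (q - w) - (p - w) := by abel
  rw [e1, norm_sub_sq_real] at h2
  nlinarith [sq_nonneg ‖p - w‖]

lemma win_of_steal (ρ : ℝ) (hρ0 : 0 < ρ) (k m n : ℕ) (hk : 1 ≤ k) (hm : 1 ≤ m)
    (hn : n = k * m) (w : Fin k × Fin m → EuclideanSpace ℝ (Fin 2))
    (a b : ℝ) (ha : a = 1 / (2 * k)) (hb : b = ρ / (2 * m))
    (hw0 : ∀ i, w i 0 = (2 * (i.1 : ℕ) + 1) * a) (hw1 : ∀ i, w i 1 = (2 * (i.2 : ℕ) + 1) * b)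
    (p : EuclideanSpace ℝ (Fin 2)) (hp : p ∈ board ρ)
    (h : volume {q | q ∈ board ρ ∧ dist q p < infDist q (range w)} >
          ENNReal.ofReal (ρ / (2 * n))) :
    ∃ B : Set (EuclideanSpace ℝ (Fin 2)), B ⊆ board ρ ∧ B.Finite ∧ B.ncard = n ∧
        volume {q | q ∈ board ρ ∧ infDist q B < infDist q (range w)} > ENNReal.ofReal (ρ / 2) := by
  classical
  have hk' : (0 : ℝ) < k := by exact_mod_cast hk
  have hm' : (0 : ℝ) < m := by exact_mod_cast hm
  have ha0 : 0 < a := by rw [ha]; positivity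
  have hb0 : 0 < b := by rw [hb]; positivity
  have hka : 2 * k * a = 1 := by rw [ha]; field_simp
  have hmb : 2 * m * b = ρ := by rw [hb]; field_simp
  have hab : 2 * a * b = ρ / (2 * n) := by rw [ha, hb, hn]; push_cast; field_simp
  have hwi : Function.Injective w := by
    intro i j hij
    have h0 := (grid_sep a (w i 0) ha0 i.1 j.1 (by rw [hw0]; simpa using ha0)).2
      (by rw [hij, hw0]; simpa using ha0)
    have h1 := (grid_sep b (w i 1) hb0 i.2 j.2 (by rw [hw1]; simpa using hb0)).2
      (by rw [hij, hw1]; simpa using hb0)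
    exact Prod.ext (Fin.ext h0) (Fin.ext h1)
  have hpw : ∀ i, p - w i ≠ 0 := by
    intro i hi
    have : p = w i := sub_eq_zero.1 hi
    have he : {q | q ∈ board ρ ∧ dist q p < infDist q (range w)} = ∅ := by
      ext q
      simp only [mem_ofPred_eq, mem_empty_iff_false, iff_false, not_and, not_lt]
      intro _
      rw [this]
      exact infDist_le_dist_of_mem (mem_range_self i)
    rw [he] at h
    simp at h
  set P := {q | q ∈ board ρ ∧ dist q p < infDist q (range w)} with hP
  let i0 : Fin k × Fin m := (⟨0, hk⟩, ⟨0, hm⟩)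
  let H : ℕ → Fin k × Fin m → Set (EuclideanSpace ℝ (Fin 2)) := fun j i =>
    {q | q ∈ cell (w i) a b ∧ inner ℝ (q - w i) (p - w i) <
      -((1 / ((j : ℝ) + 1)) * ‖p - w i‖ ^ 2 / 2)}
  have hlim : Filter.Tendsto (fun j => volume P + ∑ i ∈ Finset.univ.erase i0, volume (H j i))
      Filter.atTop (nhds (volume P + ∑ i ∈ Finset.univ.erase i0, ENNReal.ofReal (2 * a * b))) :=
    tendsto_const_nhds.add
      (tendsto_finsetSum _ fun i _ => half_tendsto (w i) (p - w i) (hpw i) a b ha0 hb0)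
  have hgt : ENNReal.ofReal (ρ / 2) <
      volume P + ∑ i ∈ Finset.univ.erase i0, ENNReal.ofReal (2 * a * b) := by
    have e1 : ENNReal.ofReal (ρ / 2) = ∑ i : Fin k × Fin m, ENNReal.ofReal (2 * a * b) := by
      rw [Finset.sum_const, ← ENNReal.ofReal_nsmul, hab, hn]
      congr 1
      simp
      field_simp
    rw [e1, ← Finset.add_sum_erase _ _ (Finset.mem_univ i0)]
    apply ENNReal.add_lt_add_right
    · exact (ENNReal.sum_lt_top.2 fun i _ => ENNReal.ofReal_lt_top).ne
    · rw [hab]; exact h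
  obtain ⟨j, hj, hjk⟩ := ((hlim.eventually_const_lt hgt).and
    (Filter.eventually_ge_atTop (2 * k + 2 * m))).exists
  have hj0 : (0 : ℝ) < (j : ℝ) + 1 := by positivity
  have hjr : (2 * k + 2 * m : ℝ) ≤ j := by exact_mod_cast hjk
  set e : ℝ := 1 / ((j : ℝ) + 1) with he
  have he0 : 0 < e := by positivity
  have hea : e ≤ a := by
    rw [he, ha]; apply one_div_le_one_div_of_le (by positivity); linarith
  have heb : e * ρ ≤ b := by
    have : e ≤ 1 / (2 * m) := by
      rw [he]; apply one_div_le_one_div_of_le (by positivity); linarith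
    have := mul_le_mul_of_nonneg_right this hρ0.le
    rw [hb]; exact this.trans_eq (one_div_mul_eq_div _ _)
  have hbd0 : ∀ i, a ≤ w i 0 ∧ w i 0 ≤ 1 - a := by
    intro i; have := grid_bd a ha0 k i.1 i.1.2; rw [hka] at this; rw [hw0]; exact this
  have hbd1 : ∀ i, b ≤ w i 1 ∧ w i 1 ≤ ρ - b := by
    intro i; have := grid_bd b hb0 m i.2 i.2.2; rw [hmb] at this; rw [hw1]; exact this
  let f : Fin k × Fin m → EuclideanSpace ℝ (Fin 2) := fun i =>
    if i = i0 then p else w i - e • (p - w i)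
  have hf0 : f i0 = p := if_pos rfl
  have hf1 : ∀ i, i ≠ i0 → f i = w i - e • (p - w i) := fun i hi => if_neg hi
  have hne : ∀ i, w i - e • (p - w i) ≠ p := by
    intro i hi
    have : (1 + e) • (p - w i) = 0 := by
      rw [add_smul, one_smul]
      nth_rewrite 1 [← hi]
      abel
    rcases smul_eq_zero.1 this with h | h
    · linarith
    · exact hpw i h
  have hfi : Function.Injective f := by
    intro i i' hii
    by_cases h1 : i = i0
    · by_cases h2 : i' = i0
      · rw [h1, h2]
      · rw [h1, hf0, hf1 _ h2] at hii
        exact absurd hii.symm (hne _)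
    · by_cases h2 : i' = i0
      · rw [h2, hf0, hf1 _ h1] at hii
        exact absurd hii (hne _)
      · rw [hf1 _ h1, hf1 _ h2] at hii
        apply hwi
        have : (1 + e) • (w i - w i') = 0 := by
          have e2 : (1 + e) • (w i - w i') =
            (w i - e • (p - w i)) - (w i' - e • (p - w i')) := by module
          rw [e2, hii, sub_self]
        rcases smul_eq_zero.1 this with h | h
        · linarith
        · exact sub_eq_zero.1 h
  refine ⟨range f, ?_, finite_range f, ?_, ?_⟩
  · rintro _ ⟨i, rfl⟩
    by_cases h1 : i = i0
    · rw [h1, hf0]; exact hp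
    · rw [hf1 _ h1]
      obtain ⟨⟨p0, p1⟩, p2, p3⟩ := hp
      obtain ⟨b0, b1⟩ := hbd0 i
      obtain ⟨b2, b3⟩ := hbd1 i
      simp only [board, mem_ofPred_eq, PiLp.sub_apply, PiLp.smul_apply, smul_eq_mul, mem_Icc]
      have t1 : e * (p 0 - w i 0) ≤ e * 1 := mul_le_mul_of_nonneg_left (by linarith) he0.le
      have t2 : e * (-1) ≤ e * (p 0 - w i 0) := mul_le_mul_of_nonneg_left (by linarith) he0.le
      have t3 : e * (p 1 - w i 1) ≤ e * ρ := mul_le_mul_of_nonneg_left (by linarith) he0.le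
      have t4 : e * (-ρ) ≤ e * (p 1 - w i 1) := mul_le_mul_of_nonneg_left (by linarith) he0.le
      refine ⟨⟨?_, ?_⟩, ?_, ?_⟩ <;> linarith
  · rw [← Nat.card_coe_set_eq, Nat.card_range_of_injective hfi, hn]
    simp
  · refine lt_of_lt_of_le hj ?_
    have hdisj : Set.PairwiseDisjoint (↑(Finset.univ.erase i0)) (H j) := by
      intro i _ i' _ hii
      rw [Function.onFun, Set.disjoint_left]
      rintro q ⟨⟨h0, h1⟩, _⟩ ⟨⟨h0', h1'⟩, _⟩
      rw [hw0] at h0 h0'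
      rw [hw1] at h1 h1'
      exact hii (Prod.ext (Fin.ext ((grid_sep a _ ha0 _ _ h0).2 h0'))
        (Fin.ext ((grid_sep b _ hb0 _ _ h1).2 h1')))
    rw [← measure_biUnion_finset hdisj (fun i _ => (half_open _ _ _ _ _).measurableSet),
      ← measure_union]
    · apply measure_mono
      rintro q (hq | hq)
      · exact ⟨hq.1, (infDist_le_dist_of_mem (Set.mem_range.2 ⟨i0, hf0⟩)).trans_lt hq.2⟩
      · simp only [mem_iUnion] at hq
        obtain ⟨i, hi, hq, hin⟩ := hq
        have hi' : i ≠ i0 := Finset.ne_of_mem_erase hi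
        obtain ⟨b0, b1⟩ := hbd0 i
        obtain ⟨b2, b3⟩ := hbd1 i
        have hq0 := abs_lt.1 hq.1
        have hq1 := abs_lt.1 hq.2
        refine ⟨⟨⟨?_, ?_⟩, ?_, ?_⟩, ?_⟩
        · linarith
        · linarith
        · linarith
        · linarith
        · refine (infDist_le_dist_of_mem (Set.mem_range.2 ⟨i, hf1 i hi'⟩)).trans_lt
            ((closer_iff q (w i) (p - w i) e he0 hin).trans_le ?_)
          rw [le_infDist ⟨w i, mem_range_self i⟩]
          rintro _ ⟨i', rfl⟩
          rw [EuclideanSpace.dist_eq, EuclideanSpace.dist_eq]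
          apply Real.sqrt_le_sqrt
          simp only [Fin.sum_univ_two, Real.dist_eq]
          obtain ⟨h0, h1⟩ := hq
          rw [hw0] at h0
          rw [hw1] at h1
          rw [hw0, hw1, hw0, hw1]
          exact add_le_add
            (pow_le_pow_left₀ (abs_nonneg _) (grid_sep a _ ha0 _ _ h0).1 2)
            (pow_le_pow_left₀ (abs_nonneg _) (grid_sep b _ hb0 _ _ h1).1 2)
    · rw [Set.disjoint_left]
      intro q hq hq'
      simp only [mem_iUnion] at hq'
      obtain ⟨i, hi, _, hin⟩ := hq'
      have := steal_inner q (w i) p (hq.2.trans_le (infDist_le_dist_of_mem (mem_range_self i)))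
      have : 0 ≤ e * ‖p - w i‖ ^ 2 / 2 := by positivity
      linarith
    · exact Finset.measurableSet_biUnion _ (fun i _ => (half_open _ _ _ _ _).measurableSet)

/-- If Wilma plays a regular `k × m` grid of `n = k·m` points, then Barney has a
winning `n`-point placement if and only if a single point can steal an area
strictly larger than `ρ / (2n)`. -/
theorem stmt_8 (ρ : ℝ) (hρ0 : 0 < ρ) (hρ1 : ρ ≤ 1) (k m n : ℕ) (hk : 1 ≤ k) (hm : 1 ≤ m)
    (hn : n = k * m) (W : Set (EuclideanSpace ℝ (Fin 2)))
    (hW : W = Set.range fun p : Fin k × Fin m =>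
      pt ((2 * (p.1 : ℝ) + 1) / (2 * k)) ((2 * (p.2 : ℝ) + 1) * ρ / (2 * m))) :
    (∃ B : Set (EuclideanSpace ℝ (Fin 2)), B ⊆ board ρ ∧ B.Finite ∧ B.ncard = n ∧
        volume {q | q ∈ board ρ ∧ infDist q B < infDist q W} > ENNReal.ofReal (ρ / 2)) ↔
    (∃ p ∈ board ρ,
        volume {q | q ∈ board ρ ∧ dist q p < infDist q W} >
          ENNReal.ofReal (ρ / (2 * n))) := by
  constructor
  · rintro ⟨B, hB, hfin, hcard, h⟩
    by_contra! hno
    apply absurd h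
    rw [gt_iff_lt, not_lt]
    have hn0 : 0 < n := by rw [hn]; positivity
    have hn' : (0 : ℝ) < n := by exact_mod_cast hn0
    have hne : B.Nonempty := by
      rw [← Set.ncard_pos hfin, hcard]; exact hn0
    have hsub : {q | q ∈ board ρ ∧ infDist q B < infDist q W} ⊆
        ⋃ p ∈ hfin.toFinset, {q | q ∈ board ρ ∧ dist q p < infDist q W} := by
      rintro q ⟨hq, hlt⟩
      obtain ⟨p, hp, hpd⟩ := (infDist_lt_iff hne).1 hlt
      simp only [mem_iUnion]
      exact ⟨p, hfin.mem_toFinset.2 hp, hq, hpd⟩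
    calc _ ≤ _ := measure_mono hsub
      _ ≤ ∑ p ∈ hfin.toFinset, volume {q | q ∈ board ρ ∧ dist q p < infDist q W} :=
        measure_biUnion_finset_le _ _
      _ ≤ ∑ p ∈ hfin.toFinset, ENNReal.ofReal (ρ / (2 * n)) :=
        Finset.sum_le_sum fun p hp => hno p (hB (hfin.mem_toFinset.1 hp))
      _ = ENNReal.ofReal (ρ / 2) := by
        rw [Finset.sum_const, ← Set.ncard_eq_toFinset_card B hfin, hcard, ← ENNReal.ofReal_nsmul]
        congr 1
        simp
        field_simp
  · rintro ⟨p, hp, h⟩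
    subst hW
    refine win_of_steal ρ hρ0 k m n hk hm hn _ _ _ rfl rfl ?_ ?_ p hp h
    · intro i
      simp [pt]
      ring
    · intro i
      simp [pt]
      ring
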